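/- Let k ≥ 3 be an integer and let c be a real number with 0 < c < 1 such that for every x ∈ (0,1/2), c·ln(1+(1−2x)^k) < ln 2 + H(x) (i.e., c < θ_k). Then E_{⌊c·n⌋,k}(Y), computed over M_{⌊c·n⌋,n,k}, tends to 1 as n → ∞. -/

import Mathlib

open Finset Filter

attribute [local instance] Classical.propDecidable

/-- `M_{L,n,k}`: the set of `L × n` matrices over `ZMod 2` with exactly `k`
nonzero entries in each row. -/
noncomputable def Mset (L n k : ℕ) : Finset (Matrix (Fin L) (Fin n) (ZMod 2)) :=
  Finset.univ.filter fun A =>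
    ∀ i : Fin L, (Finset.univ.filter fun j : Fin n => A i j ≠ 0).card = k

/-- `Y(A)`: the number of vectors in the kernel of the transpose of `A`. -/
noncomputable def Ycount {L n : ℕ} (A : Matrix (Fin L) (Fin n) (ZMod 2)) : ℕ :=
  Nat.card {u : Fin L → ZMod 2 // Matrix.vecMul u A = 0}

/-- `E_{L,k}(Y)`: the expectation of `Y` over a uniformly random `A ∈ M_{L,n,k}`
(there are `C(n,k)^L` such matrices). -/
noncomputable def EY (n L k : ℕ) : ℝ :=
  (∑ A ∈ Mset L n k, (Ycount A : ℝ)) / (n.choose k : ℝ) ^ L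

/-- `P_(r)`: the fraction of matrices in `M_{L,n,k}` of rank `r`. -/
noncomputable def Prank (n L k r : ℕ) : ℝ :=
  (((Mset L n k).filter fun A => A.rank = r).card : ℝ) / (n.choose k : ℝ) ^ L

/-- The entropy function `H(x) = x ln x + (1−x) ln(1−x)`. -/
noncomputable def Hent (x : ℝ) : ℝ := x * Real.log x + (1 - x) * Real.log (1 - x)

/-- The sign `-1` on `T` and `1` off `T`. -/
noncomputable def signOf {n : ℕ} (T : Finset (Fin n)) (j : Fin n) : ℝ := if j ∈ T then -1 else 1

/-- The `k`-th elementary symmetric function of the signs of `T`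
(a Krawtchouk polynomial in the cardinality of `T`). -/
noncomputable def signESymm {n : ℕ} (k : ℕ) (T : Finset (Fin n)) : ℝ :=
  ∑ S ∈ powersetCard k univ, ∏ j ∈ S, signOf T j

/-- The normalised `k`-th elementary symmetric mean of the signs of `T`. -/
noncomputable def signMean {n : ℕ} (k : ℕ) (T : Finset (Fin n)) : ℝ :=
  signESymm k T / n.choose k

/-- The nontrivial additive character of `ZMod 2`. -/
noncomputable def chi (b : ZMod 2) : ℝ := if b = 0 then 1 else -1

theorem chi_zero : chi 0 = 1 := by simp [chi]

theorem chi_one : chi 1 = -1 := by simp [chi]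

theorem chi_add (a b : ZMod 2) : chi (a + b) = chi a * chi b := by
  have h : ∀ x : ZMod 2, x = 0 ∨ x = 1 := by
    intro x; fin_cases x
    · left; rfl
    · right; rfl
  have h2 : (1 : ZMod 2) + 1 = 0 := by rfl
  rcases h a with rfl | rfl <;> rcases h b with rfl | rfl <;>
    simp [chi_zero, chi_one, h2]

theorem chi_sum {ι : Type*} (s : Finset ι) (f : ι → ZMod 2) :
    chi (∑ i ∈ s, f i) = ∏ i ∈ s, chi (f i) := by
  induction s using Finset.induction_on with
  | empty => simp [chi_zero]
  | insert a s ha ih => rw [sum_insert ha, prod_insert ha, chi_add, ih]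

theorem sum_finset_prod {n : ℕ} (a : Fin n → ℝ) :
    ∑ T : Finset (Fin n), ∏ j ∈ T, a j = ∏ j, (1 + a j) := by
  rw [Finset.prod_one_add, powerset_univ]

theorem sum_prod_chi {n : ℕ} (w : Fin n → ZMod 2) :
    ∑ T : Finset (Fin n), ∏ j ∈ T, chi (w j) = if w = 0 then 2 ^ n else 0 := by
  rw [sum_finset_prod]
  split_ifs with h
  · subst h
    simp [chi_zero]
    norm_num
  · obtain ⟨j, hj⟩ := Function.ne_iff.mp h
    refine prod_eq_zero (mem_univ j) ?_
    simp only [Pi.zero_apply] at hj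
    simp [chi, hj]

theorem prod_signOf_comm {n : ℕ} (S T : Finset (Fin n)) :
    ∏ j ∈ S, signOf T j = ∏ j ∈ T, signOf S j := by
  unfold signOf
  rw [prod_ite_mem, prod_ite_mem, inter_comm]

theorem signOf_mul_self {n : ℕ} (T : Finset (Fin n)) (j : Fin n) :
    signOf T j * signOf T j = 1 := by
  unfold signOf; split_ifs <;> norm_num

theorem abs_signOf {n : ℕ} (T : Finset (Fin n)) (j : Fin n) : |signOf T j| = 1 := by
  unfold signOf; split_ifs <;> norm_num

theorem abs_signESymm_le {n : ℕ} (k : ℕ) (T : Finset (Fin n)) :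
    |signESymm k T| ≤ n.choose k := by
  unfold signESymm
  refine (abs_sum_le_sum_abs _ _).trans ?_
  simp [abs_prod, abs_signOf]

theorem abs_signMean_le_one {n : ℕ} (k : ℕ) (T : Finset (Fin n)) : |signMean k T| ≤ 1 := by
  unfold signMean
  rw [abs_div, Nat.abs_cast]
  exact div_le_one_of_le₀ (abs_signESymm_le k T) (Nat.cast_nonneg _)

theorem sum_prod_signOf_mul {n : ℕ} (S S' : Finset (Fin n)) :
    ∑ T : Finset (Fin n), (∏ j ∈ S, signOf T j) * ∏ j ∈ S', signOf T j
      = if S = S' then 2 ^ n else 0 := by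
  have h : ∀ T : Finset (Fin n), (∏ j ∈ S, signOf T j) * ∏ j ∈ S', signOf T j
      = ∏ j ∈ T, (signOf S j * signOf S' j) := by
    intro T
    rw [prod_signOf_comm S, prod_signOf_comm S', prod_mul_distrib]
  simp_rw [h]
  rw [sum_finset_prod]
  split_ifs with hS
  · subst hS
    simp_rw [signOf_mul_self]
    norm_num
  · have : ∃ j, ¬ (j ∈ S ↔ j ∈ S') := by
      by_contra! hc
      exact hS (Finset.ext hc)
    obtain ⟨j, hj⟩ := this
    refine prod_eq_zero (mem_univ j) ?_
    unfold signOf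
    by_cases h1 : j ∈ S <;> by_cases h2 : j ∈ S' <;> simp_all

theorem sum_signESymm_sq (n k : ℕ) :
    ∑ T : Finset (Fin n), signESymm k T ^ 2 = 2 ^ n * n.choose k := by
  unfold signESymm
  simp_rw [sq, sum_mul_sum]
  rw [sum_comm]
  simp_rw [sum_comm (s := (univ : Finset (Finset (Fin n)))), sum_prod_signOf_mul]
  rw [sum_congr rfl (g := fun _ => (2 : ℝ) ^ n)]
  · simp [mul_comm]
  · intro S hS
    rw [sum_ite_eq, if_pos hS]

theorem sum_signMean_sq {n k : ℕ} (h : k ≤ n) :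
    ∑ T : Finset (Fin n), signMean k T ^ 2 = 2 ^ n / n.choose k := by
  have : (n.choose k : ℝ) ≠ 0 := by exact_mod_cast (Nat.choose_pos h).ne'
  unfold signMean
  simp_rw [div_pow]
  rw [← sum_div, sum_signESymm_sq]
  field_simp

/-- The vectors over `ZMod 2` with exactly `k` nonzero entries. -/
noncomputable def rowSet (n k : ℕ) : Finset (Fin n → ZMod 2) :=
  univ.filter fun r => (univ.filter fun j : Fin n => r j ≠ 0).card = k

theorem sum_rowSet {n : ℕ} (k : ℕ) (g : Finset (Fin n) → ℝ) :
    ∑ r ∈ rowSet n k, g (univ.filter fun j : Fin n => r j ≠ 0)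
      = ∑ S ∈ powersetCard k univ, g S := by
  refine sum_bij' (fun r _ => univ.filter fun j : Fin n => r j ≠ 0)
    (fun S _ => fun j => if j ∈ S then 1 else 0) ?_ ?_ ?_ ?_ ?_
  · intro r hr
    simpa [rowSet, mem_powersetCard] using hr
  · intro S hS
    simpa [rowSet, mem_powersetCard] using hS
  · intro r _
    have h : ∀ x : ZMod 2, x ≠ 0 → x = 1 := by decide
    ext1 j
    by_cases hj : r j = 0
    · simp [hj]
    · simp [h _ hj]
  · intro S _
    ext j
    simp
  · intros; rfl

theorem card_rowSet (n k : ℕ) : ((rowSet n k).card : ℝ) = n.choose k := by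
  have := sum_rowSet (n := n) k (fun _ => 1)
  simpa using this

theorem sum_rowSet_prod_chi {n : ℕ} (k : ℕ) (T : Finset (Fin n)) :
    ∑ r ∈ rowSet n k, ∏ j ∈ T, chi (r j) = signESymm k T := by
  unfold signESymm
  rw [← sum_rowSet k (fun S => ∏ j ∈ S, signOf T j)]
  refine sum_congr rfl fun r _ => ?_
  rw [prod_signOf_comm]
  refine prod_congr rfl fun j _ => ?_
  by_cases hj : r j = 0 <;> simp [chi, signOf, hj]

theorem Mset_eq_piFinset (L n k : ℕ) :
    Mset L n k = Fintype.piFinset fun _ : Fin L => rowSet n k := by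
  ext A
  rw [Mset, mem_filter]
  refine (and_iff_right (mem_univ A)).trans (Iff.trans ?_ Fintype.mem_piFinset.symm)
  refine forall_congr' fun i => ?_
  rw [rowSet, mem_filter]
  exact (and_iff_right (mem_univ _)).symm

theorem Ycount_eq {L n : ℕ} (A : Matrix (Fin L) (Fin n) (ZMod 2)) :
    (Ycount A : ℝ) = ∑ u : Fin L → ZMod 2, if Matrix.vecMul u A = 0 then 1 else 0 := by
  unfold Ycount
  rw [Nat.card_eq_fintype_card, Fintype.card_subtype]
  simp

theorem sum_Ycount (L n k : ℕ) :
    2 ^ n * ∑ A ∈ Mset L n k, (Ycount A : ℝ)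
      = ∑ T : Finset (Fin n), (n.choose k + signESymm k T) ^ L := by
  have h1 : ∀ (A : Matrix (Fin L) (Fin n) (ZMod 2)) (u : Fin L → ZMod 2),
      2 ^ n * (if Matrix.vecMul u A = 0 then (1 : ℝ) else 0)
        = ∑ T : Finset (Fin n), ∏ i, ∏ j ∈ T, chi (u i * A i j) := by
    intro A u
    rw [mul_ite, mul_one, mul_zero, ← sum_prod_chi]
    refine sum_congr rfl fun T _ => ?_
    refine Eq.trans (prod_congr rfl fun j _ => ?_) prod_comm
    exact chi_sum univ fun i => u i * A i j
  simp_rw [Ycount_eq, mul_sum, h1]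
  simp_rw [sum_comm (t := (univ : Finset (Finset (Fin n))))]
  refine sum_congr rfl fun T _ => ?_
  rw [sum_comm, Mset_eq_piFinset]
  have h2 : ∀ u : Fin L → ZMod 2,
      ∑ A ∈ Fintype.piFinset (fun _ : Fin L => rowSet n k),
        ∏ i, ∏ j ∈ T, chi (u i * A i j)
      = ∏ i, ∑ r ∈ rowSet n k, ∏ j ∈ T, chi (u i * r j) := by
    intro u
    rw [prod_univ_sum]
  refine (sum_congr rfl fun u _ => h2 u).trans ?_
  rw [← Fintype.sum_pow (fun b : ZMod 2 => ∑ r ∈ rowSet n k, ∏ j ∈ T, chi (b * r j)) L]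
  congr 1
  have h3 : ∀ f : ZMod 2 → ℝ, ∑ b, f b = f 0 + f 1 := fun f => Fin.sum_univ_two f
  rw [h3]
  simp only [zero_mul, one_mul, chi_zero, prod_const_one, sum_rowSet_prod_chi]
  simp [card_rowSet]

theorem EY_eq_sum_signMean {L n k : ℕ} (h : k ≤ n) :
    EY n L k = (∑ T : Finset (Fin n), (1 + signMean k T) ^ L) / 2 ^ n := by
  have hC : (n.choose k : ℝ) ≠ 0 := by exact_mod_cast (Nat.choose_pos h).ne'
  have h1 : ∀ T : Finset (Fin n), (1 + signMean k T) ^ L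
      = (n.choose k + signESymm k T) ^ L / (n.choose k : ℝ) ^ L := by
    intro T
    rw [← div_pow, add_div, div_self hC, signMean]
  simp_rw [h1]
  rw [← sum_div, ← sum_Ycount, EY]
  field_simp

theorem sum_signOf {n : ℕ} (T : Finset (Fin n)) :
    ∑ j, signOf T j = n - 2 * T.card := by
  unfold signOf
  have : ∀ j : Fin n, (if j ∈ T then (-1 : ℝ) else 1) = 1 - 2 * (if j ∈ T then 1 else 0) := by
    intro j; split_ifs <;> norm_num
  simp_rw [this]
  rw [sum_sub_distrib, ← mul_sum]
  simp

theorem succ_mul_signESymm {n : ℕ} (k : ℕ) (T : Finset (Fin n)) :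
    (k + 1) * signESymm (k + 1) T
      = ∑ S ∈ powersetCard k univ, ∑ a ∈ univ \ S, (∏ j ∈ S, signOf T j) * signOf T a := by
  have h1 : (k + 1 : ℝ) * signESymm (k + 1) T
      = ∑ S ∈ powersetCard (k + 1) univ, ∑ a ∈ S, ∏ j ∈ S, signOf T j := by
    unfold signESymm
    rw [mul_sum]
    refine sum_congr rfl fun S hS => ?_
    rw [sum_const, (mem_powersetCard.mp hS).2]
    simp
  rw [h1, sum_sigma', sum_sigma']
  refine sum_bij' (fun p _ => ⟨p.1.erase p.2, p.2⟩) (fun p _ => ⟨insert p.2 p.1, p.2⟩)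
    ?_ ?_ ?_ ?_ ?_
  · rintro ⟨S, a⟩ h
    simp only [mem_sigma, mem_powersetCard_univ] at h
    simp [h.1, h.2, card_erase_of_mem]
  · rintro ⟨S, a⟩ h
    simp only [mem_sigma, mem_powersetCard_univ, Finset.mem_sdiff, mem_univ, true_and] at h
    simp [h.1, h.2, card_insert_of_notMem]
  · rintro ⟨S, a⟩ h
    simp only [mem_sigma, mem_powersetCard_univ] at h
    simp [insert_erase h.2]
  · rintro ⟨S, a⟩ h
    simp only [mem_sigma, mem_powersetCard_univ, Finset.mem_sdiff, mem_univ, true_and] at h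
    simp [erase_insert h.2]
  · rintro ⟨S, a⟩ h
    simp only [mem_sigma, mem_powersetCard_univ] at h
    exact (prod_erase_mul _ _ h.2).symm

theorem abs_signESymm_succ_sub {n : ℕ} (k : ℕ) (T : Finset (Fin n)) :
    |(k + 1) * signESymm (k + 1) T - (∑ j, signOf T j) * signESymm k T|
      ≤ k * n.choose k := by
  have h : (k + 1) * signESymm (k + 1) T - (∑ j, signOf T j) * signESymm k T
      = - ∑ S ∈ powersetCard k univ, (∏ j ∈ S, signOf T j) * ∑ a ∈ S, signOf T a := by
    rw [succ_mul_signESymm, signESymm, mul_sum, ← sum_sub_distrib, ← sum_neg_distrib]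
    refine sum_congr rfl fun S _ => ?_
    rw [← mul_sum, ← sum_sdiff (subset_univ S)]
    ring
  rw [h, abs_neg]
  refine (abs_sum_le_sum_abs _ _).trans ?_
  calc _ ≤ ∑ S ∈ powersetCard k (univ : Finset (Fin n)), (k : ℝ) := by
        refine sum_le_sum fun S hS => ?_
        rw [abs_mul, abs_prod]
        simp only [abs_signOf, prod_const_one, one_mul]
        refine (abs_sum_le_sum_abs _ _).trans ?_
        simp [abs_signOf, (mem_powersetCard.mp hS).2]
    _ = _ := by simp [mul_comm]

/-- The fraction of `1`s minus the fraction of `-1`s among the signs of `T`. -/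
noncomputable def bias {n : ℕ} (T : Finset (Fin n)) : ℝ := 1 - 2 * (T.card / n : ℝ)

theorem abs_bias_le_one {n : ℕ} (T : Finset (Fin n)) : |bias T| ≤ 1 := by
  have h1 : (T.card / n : ℝ) ≤ 1 :=
    div_le_one_of_le₀ (by exact_mod_cast (card_le_univ T).trans_eq (Fintype.card_fin n))
      (Nat.cast_nonneg _)
  have h0 : (0 : ℝ) ≤ T.card / n := by positivity
  unfold bias
  rw [abs_le]
  constructor <;> linarith

theorem abs_signMean_sub_bias_pow {n : ℕ} (k : ℕ) (hk : k ≤ n) (hn : 0 < n)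
    (T : Finset (Fin n)) : |signMean k T - bias T ^ k| ≤ k ^ 2 / n := by
  have hn' : (0 : ℝ) < n := by exact_mod_cast hn
  induction k with
  | zero => simp [signMean, signESymm]
  | succ k ih =>
    have ih := ih (by omega)
    have hC : (0 : ℝ) < n.choose k := by exact_mod_cast Nat.choose_pos (by omega)
    have hC1 : (0 : ℝ) < n.choose (k + 1) := by exact_mod_cast Nat.choose_pos hk
    have hrel : (n.choose (k + 1) : ℝ) * (k + 1) = n.choose k * (n - k) := by
      have := Nat.choose_succ_right_eq n k
      rw [← Nat.cast_sub (by omega : k ≤ n)]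
      exact_mod_cast this
    have h1 := abs_signESymm_succ_sub k T
    have e1 : signESymm (k + 1) T = signMean (k + 1) T * n.choose (k + 1) := by
      unfold signMean; field_simp
    have e0 : signESymm k T = signMean k T * n.choose k := by
      unfold signMean; field_simp
    have eb : ∑ j, signOf T j = n * bias T := by
      rw [sum_signOf, bias]; field_simp
    have h2 : |(n - k) * signMean (k + 1) T - n * bias T * signMean k T| ≤ k := by
      have : (k + 1) * signESymm (k + 1) T - (∑ j, signOf T j) * signESymm k T
          = ((n - k) * signMean (k + 1) T - n * bias T * signMean k T) * n.choose k := by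
        rw [e1, e0, eb]
        linear_combination signMean (k + 1) T * hrel
      rw [this, abs_mul, abs_of_pos hC] at h1
      exact le_of_mul_le_mul_right h1 hC
    have h3 : n * (signMean (k + 1) T - bias T ^ (k + 1))
        = ((n - k) * signMean (k + 1) T - n * bias T * signMean k T)
          + k * signMean (k + 1) T + n * (bias T * (signMean k T - bias T ^ k)) := by ring
    have h4 : |(k : ℝ) * signMean (k + 1) T| ≤ k := by
      rw [abs_mul, Nat.abs_cast]
      exact mul_le_of_le_one_right (Nat.cast_nonneg _) (abs_signMean_le_one _ _)
    have h5 : |n * (bias T * (signMean k T - bias T ^ k))| ≤ k ^ 2 := by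
      rw [abs_mul, Nat.abs_cast, abs_mul]
      rw [le_div_iff₀ hn'] at ih
      nlinarith [abs_bias_le_one T, abs_nonneg (signMean k T - bias T ^ k),
        mul_le_of_le_one_left (abs_nonneg (signMean k T - bias T ^ k)) (abs_bias_le_one T)]
    rw [le_div_iff₀ hn', mul_comm]
    nth_rewrite 1 [← Nat.abs_cast n]
    rw [← abs_mul, h3]
    refine (abs_add_three _ _ _).trans ?_
    push_cast
    nlinarith

theorem continuous_Hent : Continuous Hent := by
  unfold Hent
  exact Real.continuous_mul_log.add
    (Real.continuous_mul_log.comp (continuous_const.sub continuous_id))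

theorem Hent_one_sub (x : ℝ) : Hent (1 - x) = Hent x := by
  unfold Hent
  rw [sub_sub_cancel, add_comm]

theorem choose_mul_exp_Hent_le_one {n j : ℕ} (hj : j ≤ n) (hn : 0 < n) :
    n.choose j * Real.exp (n * Hent (j / n)) ≤ 1 := by
  have hn' : (0 : ℝ) < n := by exact_mod_cast hn
  have hx0 : (0 : ℝ) ≤ j / n := by positivity
  have hx1 : (j / n : ℝ) ≤ 1 := div_le_one_of_le₀ (by exact_mod_cast hj) hn'.le
  set x : ℝ := j / n with hx
  have hjx : (j : ℝ) = n * x := by rw [hx]; field_simp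
  have key : ∀ (m : ℕ) (y : ℝ), 0 ≤ y → (m : ℝ) = n * y →
      Real.exp (n * (y * Real.log y)) = y ^ m := by
    intro m y hy hm
    rcases hy.eq_or_lt with rfl | hy
    · have : m = 0 := by
        rw [mul_zero] at hm
        exact_mod_cast hm
      simp [this]
    · rw [← mul_assoc, ← hm, Real.exp_nat_mul, Real.exp_log hy]
  have h1 := key j x hx0 hjx
  have h2 := key (n - j) (1 - x) (by linarith) (by rw [Nat.cast_sub hj, hjx]; ring)
  have h3 : Real.exp (n * Hent x) = x ^ j * (1 - x) ^ (n - j) := by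
    rw [Hent, mul_add, Real.exp_add, h1, h2]
  rw [h3]
  have h4 : ∑ m ∈ range (n + 1), x ^ m * (1 - x) ^ (n - m) * n.choose m = 1 := by
    rw [← add_pow]; simp
  refine le_of_le_of_eq ?_ h4
  rw [mul_comm]
  refine single_le_sum (f := fun m => x ^ m * (1 - x) ^ (n - m) * (n.choose m : ℝ)) ?_
    (mem_range.mpr (by omega))
  intro m _
  have : 0 ≤ 1 - x := by linarith
  positivity

theorem sum_exp_Hent_le {n : ℕ} (hn : 0 < n) :
    ∑ T : Finset (Fin n), Real.exp (n * Hent (T.card / n)) ≤ n + 1 := by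
  have h := sum_powerset_apply_card (fun j : ℕ => Real.exp (n * Hent (j / n)))
    (x := (univ : Finset (Fin n)))
  rw [powerset_univ] at h
  rw [h, card_univ, Fintype.card_fin]
  calc _ ≤ ∑ m ∈ range (n + 1), (1 : ℝ) := by
        refine sum_le_sum fun m hm => ?_
        rw [nsmul_eq_mul]
        exact choose_mul_exp_Hent_le_one (by have := mem_range.mp hm; omega) hn
    _ = _ := by simp

theorem sq_div_six_le_log_two_add_Hent {y : ℝ} (h0 : 0 ≤ y) (h1 : y ≤ 1) :
    y ^ 2 / 6 ≤ Real.log 2 + Hent ((1 - y) / 2) := by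
  have e : Real.log 2 + Hent ((1 - y) / 2)
      = ((1 - y) * Real.log (1 - y) + (1 + y) * Real.log (1 + y)) / 2 := by
    have e2 : 1 - (1 - y) / 2 = (1 + y) / 2 := by ring
    unfold Hent
    rw [e2, Real.log_div (by linarith : (1 + y) ≠ 0) two_ne_zero]
    rcases h1.eq_or_lt with rfl | h1
    · norm_num
    · rw [Real.log_div (by linarith) two_ne_zero]
      ring
  have hA : -y ≤ (1 - y) * Real.log (1 - y) := by
    rcases h1.eq_or_lt with rfl | h1
    · norm_num
    · have hp : 0 < 1 - y := by linarith
      have := mul_le_mul_of_nonneg_left (Real.one_sub_inv_le_log_of_pos hp) hp.le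
      have e3 : (1 - y) * (1 - (1 - y)⁻¹) = -y := by field_simp; ring
      linarith
  have hB : y + y ^ 2 / 3 ≤ (1 + y) * Real.log (1 + y) := by
    have := mul_le_mul_of_nonneg_left (Real.le_log_one_add_of_nonneg h0)
      (by linarith : 0 ≤ 1 + y)
    refine le_trans ?_ this
    rw [mul_div_assoc', le_div_iff₀ (by linarith)]
    nlinarith [mul_nonneg h0 h0, mul_nonneg (mul_nonneg h0 h0) (sub_nonneg.mpr h1)]
  rw [e]
  linarith

theorem exists_quadratic_gap {k : ℕ} (hk : 3 ≤ k) {c : ℝ} (hc0 : 0 < c) (hc1 : c < 1)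
    (hθ : ∀ x : ℝ, 0 < x → x < 1 / 2 →
      c * Real.log (1 + (1 - 2 * x) ^ k) < Real.log 2 + Hent x) :
    ∃ η : ℝ, 0 < η ∧ ∀ x : ℝ, 0 ≤ x → x ≤ 1 →
      c * Real.log (1 + |1 - 2 * x| ^ k) + η * (1 - 2 * x) ^ 2 ≤ Real.log 2 + Hent x := by
  suffices h : ∃ η : ℝ, 0 < η ∧ ∀ x : ℝ, 0 ≤ x → x ≤ 1 / 2 →
      c * Real.log (1 + (1 - 2 * x) ^ k) + η * (1 - 2 * x) ^ 2 ≤ Real.log 2 + Hent x by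
    obtain ⟨η, hη, h⟩ := h
    refine ⟨η, hη, fun x hx0 hx1 => ?_⟩
    rcases le_total x (1 / 2) with hx | hx
    · rw [abs_of_nonneg (by linarith)]
      exact h x hx0 hx
    · have := h (1 - x) (by linarith) (by linarith)
      rw [Hent_one_sub] at this
      rw [abs_of_nonpos (by linarith)]
      have e : 1 - 2 * (1 - x) = -(1 - 2 * x) := by ring
      rw [e, neg_sq] at this
      exact this
  let g : ℝ → ℝ := fun x => Real.log 2 + Hent x - c * Real.log (1 + (1 - 2 * x) ^ k)
  have hpos : ∀ x ∈ Set.Icc (0 : ℝ) (11 / 24), 1 + (1 - 2 * x) ^ k ≠ 0 := by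
    intro x hx
    have : 0 ≤ (1 - 2 * x) ^ k := pow_nonneg (by linarith [hx.2]) k
    positivity
  have hg : ContinuousOn g (Set.Icc 0 (11 / 24)) := by
    refine (continuous_const.add continuous_Hent).continuousOn.sub
      (continuousOn_const.mul (ContinuousOn.log ?_ hpos))
    fun_prop
  obtain ⟨x₀, hx₀, hmin⟩ := isCompact_Icc.exists_isMinOn
    (Set.nonempty_Icc.mpr (by norm_num : (0 : ℝ) ≤ 11 / 24)) hg
  have hg0 : 0 < g x₀ := by
    rcases hx₀.1.eq_or_lt with h | h
    · rw [← h]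
      have := Real.log_pos one_lt_two
      simp only [g, Hent]
      norm_num
      nlinarith
    · exact sub_pos.mpr (hθ x₀ h (by linarith [hx₀.2]))
  refine ⟨min (1 / 12) (g x₀), lt_min (by norm_num) hg0, fun x hx0 hx1 => ?_⟩
  have hy0 : 0 ≤ 1 - 2 * x := by linarith
  have hy1 : 1 - 2 * x ≤ 1 := by linarith
  rcases le_total x (11 / 24) with hx | hx
  · have h1 : g x₀ ≤ g x := hmin ⟨hx0, hx⟩
    have h2 : min (1 / 12) (g x₀) * (1 - 2 * x) ^ 2 ≤ g x₀ := by
      calc _ ≤ g x₀ * 1 := by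
            gcongr
            · exact min_le_right _ _
            · exact pow_le_one₀ hy0 hy1
        _ = _ := mul_one _
    simp only [g] at h1 h2 ⊢
    linarith
  · have h1 := sq_div_six_le_log_two_add_Hent hy0 hy1
    have e : (1 - (1 - 2 * x)) / 2 = x := by ring
    rw [e] at h1
    have h2 : min (1 / 12) (g x₀) * (1 - 2 * x) ^ 2 ≤ 1 / 12 * (1 - 2 * x) ^ 2 := by
      gcongr
      exact min_le_left _ _
    have h3 : (1 - 2 * x) ^ k ≤ 1 / 12 * (1 - 2 * x) ^ 2 := by
      calc (1 - 2 * x) ^ k ≤ (1 - 2 * x) ^ 3 := pow_le_pow_of_le_one hy0 hy1 hk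
        _ = (1 - 2 * x) * (1 - 2 * x) ^ 2 := by ring
        _ ≤ _ := by gcongr; linarith
    have h4 : 0 ≤ (1 - 2 * x) ^ k := pow_nonneg hy0 k
    have h5 : c * Real.log (1 + (1 - 2 * x) ^ k) ≤ (1 - 2 * x) ^ k := by
      have hl := Real.log_le_sub_one_of_pos (by linarith : 0 < 1 + (1 - 2 * x) ^ k)
      have hl0 := Real.log_nonneg (by linarith : 1 ≤ 1 + (1 - 2 * x) ^ k)
      nlinarith
    linarith

theorem abs_one_add_pow_sub_one_le {a : ℝ} (ha : -1 ≤ a) (L : ℕ) :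
    |(1 + a) ^ L - 1| ≤ L * |a| * Real.exp (L * |a|) := by
  have hb : 0 ≤ L * |a| := by positivity
  have hle : |L * a| = L * |a| := by rw [abs_mul, Nat.abs_cast]
  have hla := abs_le.mp hle.le
  rw [abs_le]
  constructor
  · have h1 := one_add_mul_le_pow (by linarith : -2 ≤ a) L
    have h2 := Real.one_le_exp hb
    nlinarith
  · have h1 : (1 + a) ^ L ≤ Real.exp (L * |a|) := by
      calc (1 + a) ^ L ≤ Real.exp a ^ L :=
            pow_le_pow_left₀ (by linarith) (by linarith [Real.add_one_le_exp a]) L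
        _ = Real.exp (L * a) := (Real.exp_nat_mul a L).symm
        _ ≤ _ := Real.exp_le_exp.mpr hla.2
    have h2 := Real.one_sub_le_exp_neg (L * |a|)
    have h3 : Real.exp (L * |a|) * Real.exp (-(L * |a|)) = 1 := by
      rw [← Real.exp_add]; simp
    nlinarith [Real.exp_pos (L * |a|)]

theorem abs_one_add_pow_sub_one_le' {a : ℝ} (ha : -1 ≤ a) (L : ℕ) :
    |(1 + a) ^ L - 1| ≤ (1 + |a|) ^ L := by
  have h0 : 0 ≤ (1 + a) ^ L := pow_nonneg (by linarith) L
  have h1 : (1 + a) ^ L ≤ (1 + |a|) ^ L :=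
    pow_le_pow_left₀ (by linarith) (by linarith [le_abs_self a]) L
  have h2 : 1 ≤ (1 + |a|) ^ L := one_le_pow₀ (by linarith [abs_nonneg a])
  rw [abs_le]
  constructor <;> linarith

theorem one_add_pow_le_exp {n k L : ℕ} {c η x a : ℝ} (hn : 0 < n)
    (hL : (L : ℝ) ≤ c * n) (hLn : (L : ℝ) ≤ n)
    (hη : c * Real.log (1 + |1 - 2 * x| ^ k) + η * (1 - 2 * x) ^ 2 ≤ Real.log 2 + Hent x)
    (ha : |a| ≤ |1 - 2 * x| ^ k + k ^ 2 / n) :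
    (1 + |a|) ^ L ≤
      Real.exp (k ^ 2) * 2 ^ n * Real.exp (n * Hent x) * Real.exp (-η * (n * (1 - 2 * x) ^ 2)) := by
  have hn' : (0 : ℝ) < n := by exact_mod_cast hn
  set p := |1 - 2 * x| ^ k with hp
  have hp0 : 0 ≤ p := by positivity
  set b : ℝ := k ^ 2 / n with hb
  have hb0 : 0 ≤ b := by positivity
  have hnb : n * b = k ^ 2 := by rw [hb]; field_simp
  have h1 : 1 + |a| ≤ Real.exp (Real.log (1 + p) + b) := by
    rw [Real.exp_add, Real.exp_log (by linarith)]
    nlinarith [Real.add_one_le_exp b]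
  have hlog : 0 ≤ Real.log (1 + p) := Real.log_nonneg (by linarith)
  have h2 : (2 : ℝ) ^ n = Real.exp (n * Real.log 2) := by
    rw [Real.exp_nat_mul, Real.exp_log two_pos]
  calc (1 + |a|) ^ L ≤ Real.exp (Real.log (1 + p) + b) ^ L :=
        pow_le_pow_left₀ (by positivity) h1 L
    _ = Real.exp (L * (Real.log (1 + p) + b)) := (Real.exp_nat_mul _ L).symm
    _ ≤ _ := by
      rw [h2, ← Real.exp_add, ← Real.exp_add, ← Real.exp_add]
      refine Real.exp_le_exp.mpr ?_
      have h3 := mul_le_mul_of_nonneg_right hL hlog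
      have h4 := mul_le_mul_of_nonneg_right hLn hb0
      have h5 := mul_le_mul_of_nonneg_left hη hn'.le
      nlinarith

theorem abs_one_add_signMean_pow_sub_one_le {n k L : ℕ} {c η t : ℝ} (hk : 3 ≤ k) (hkn : k ≤ n)
    (hL : (L : ℝ) ≤ c * n) (hLn : (L : ℝ) ≤ n) (hη0 : 0 < η)
    (hη : ∀ x : ℝ, 0 ≤ x → x ≤ 1 →
      c * Real.log (1 + |1 - 2 * x| ^ k) + η * (1 - 2 * x) ^ 2 ≤ Real.log 2 + Hent x)
    (ht0 : 0 < t) (ht : t ^ 3 = n) (T : Finset (Fin n)) :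
    |(1 + signMean k T) ^ L - 1| ≤
      Real.exp (1 + k ^ 2) * n * |signMean k T|
        + Real.exp (k ^ 2) * 2 ^ n * Real.exp (n * Hent (T.card / n)) * Real.exp (-(η * t)) := by
  have hn : 0 < n := by omega
  have hn' : (0 : ℝ) < n := by exact_mod_cast hn
  set a := signMean k T with ha
  have ha1 : -1 ≤ a := (abs_le.mp (abs_signMean_le_one k T)).1
  have hbias : |a| ≤ |bias T| ^ k + k ^ 2 / n := by
    have h := abs_signMean_sub_bias_pow k hkn hn T
    have h' := abs_sub_abs_le_abs_sub (signMean k T) (bias T ^ k)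
    rw [abs_pow] at h'
    linarith
  rcases le_or_gt (t * |bias T|) 1 with hy | hy
  · have h1 : n * |bias T| ^ k ≤ 1 := by
      calc n * |bias T| ^ k ≤ n * |bias T| ^ 3 := by
            gcongr n * ?_
            exact pow_le_pow_of_le_one (abs_nonneg _) (abs_bias_le_one T) hk
        _ = (t * |bias T|) ^ 3 := by rw [← ht]; ring
        _ ≤ 1 := pow_le_one₀ (by positivity) hy
    have h2 : L * |a| ≤ 1 + k ^ 2 := by
      calc L * |a| ≤ n * |a| := by gcongr
        _ ≤ n * (|bias T| ^ k + k ^ 2 / n) := by gcongr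
        _ = n * |bias T| ^ k + k ^ 2 := by field_simp
        _ ≤ _ := by linarith
    have h3 : |(1 + a) ^ L - 1| ≤ Real.exp (1 + k ^ 2) * n * |a| := by
      calc _ ≤ L * |a| * Real.exp (L * |a|) := abs_one_add_pow_sub_one_le ha1 L
        _ ≤ n * |a| * Real.exp (1 + k ^ 2) := by gcongr
        _ = _ := by ring
    have h4 : 0 ≤ Real.exp (k ^ 2) * 2 ^ n * Real.exp (n * Hent (T.card / n))
        * Real.exp (-(η * t)) := by positivity
    linarith
  · have hx1 : (T.card / n : ℝ) ≤ 1 :=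
      div_le_one_of_le₀ (by exact_mod_cast (card_le_univ T).trans_eq (Fintype.card_fin n)) hn'.le
    have h1 := one_add_pow_le_exp (L := L) hn hL hLn (hη (T.card / n) (by positivity) hx1)
      hbias
    have h2 : t ≤ n * (1 - 2 * (T.card / n : ℝ)) ^ 2 := by
      change t ≤ n * bias T ^ 2
      rw [← ht, ← sq_abs]
      nlinarith [one_lt_pow₀ hy two_ne_zero]
    have h3 : Real.exp (-η * (n * (1 - 2 * (T.card / n : ℝ)) ^ 2)) ≤ Real.exp (-(η * t)) := by
      refine Real.exp_le_exp.mpr ?_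
      nlinarith
    have h4 : 0 ≤ Real.exp (1 + k ^ 2) * n * |a| := by positivity
    have h5 := (abs_one_add_pow_sub_one_le' ha1 L).trans h1
    have h6 := mul_le_mul_of_nonneg_left h3
      (by positivity : 0 ≤ Real.exp (k ^ 2) * 2 ^ n * Real.exp (n * Hent (T.card / n)))
    linarith

theorem sum_abs_signMean_le {n k : ℕ} (hkn : k ≤ n) :
    ∑ T : Finset (Fin n), |signMean k T| ≤ 2 ^ n * √(1 / n.choose k) := by
  have h : (∑ T : Finset (Fin n), |signMean k T|) ^ 2
      ≤ 2 ^ n * (2 ^ n / n.choose k) := by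
    refine sq_sum_le_card_mul_sum_sq.trans_eq ?_
    simp_rw [sq_abs]
    rw [sum_signMean_sq hkn]
    simp
  refine (Real.le_sqrt_of_sq_le h).trans_eq ?_
  have e : (2 : ℝ) ^ n * (2 ^ n / n.choose k) = (2 ^ n) ^ 2 * (1 / n.choose k) := by ring
  rw [e, Real.sqrt_mul (by positivity), Real.sqrt_sq (by positivity)]

theorem abs_EY_sub_one_le {n k L : ℕ} {c η t : ℝ} (hk : 3 ≤ k) (hkn : k ≤ n)
    (hL : (L : ℝ) ≤ c * n) (hLn : (L : ℝ) ≤ n) (hη0 : 0 < η)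
    (hη : ∀ x : ℝ, 0 ≤ x → x ≤ 1 →
      c * Real.log (1 + |1 - 2 * x| ^ k) + η * (1 - 2 * x) ^ 2 ≤ Real.log 2 + Hent x)
    (ht0 : 0 < t) (ht : t ^ 3 = n) :
    |EY n L k - 1| ≤ Real.exp (1 + k ^ 2) * (n * √(1 / n.choose k))
      + Real.exp (k ^ 2) * ((t ^ 3 + 1) * Real.exp (-(η * t))) := by
  have h2 : (0 : ℝ) < 2 ^ n := by positivity
  have e : EY n L k - 1
      = (∑ T : Finset (Fin n), ((1 + signMean k T) ^ L - 1)) / 2 ^ n := by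
    rw [EY_eq_sum_signMean hkn, sum_sub_distrib, sub_div]
    simp
  rw [e, abs_div, abs_of_pos h2, div_le_iff₀ h2]
  refine (abs_sum_le_sum_abs _ _).trans ?_
  refine (sum_le_sum fun T _ =>
    abs_one_add_signMean_pow_sub_one_le hk hkn hL hLn hη0 hη ht0 ht T).trans ?_
  rw [sum_add_distrib, ← mul_sum, ← sum_mul, ← mul_sum, ht]
  have h3 := sum_abs_signMean_le hkn
  have h4 := sum_exp_Hent_le (n := n) (by omega)
  calc _ ≤ Real.exp (1 + k ^ 2) * n * (2 ^ n * √(1 / n.choose k))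
        + Real.exp (k ^ 2) * 2 ^ n * (n + 1) * Real.exp (-(η * t)) := by gcongr
    _ = _ := by ring

theorem tendsto_mul_sqrt_one_div_choose {k : ℕ} (hk : 3 ≤ k) :
    Tendsto (fun n : ℕ => (n : ℝ) * √(1 / n.choose k)) atTop (nhds 0) := by
  have h : Tendsto (fun n : ℕ => √(8 * k.factorial / n : ℝ)) atTop (nhds 0) := by
    rw [← Real.sqrt_zero]
    exact (Real.continuous_sqrt.tendsto 0).comp (tendsto_const_div_atTop_nhds_zero_nat _)
  refine squeeze_zero' (Eventually.of_forall fun n => by positivity) ?_ h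
  filter_upwards [eventually_ge_atTop (2 * k)] with n hn
  have hn0 : (0 : ℝ) < n := by exact_mod_cast (by omega : 0 < n)
  have hn2 : (2 : ℝ) ≤ n := by exact_mod_cast (by omega : 2 ≤ n)
  refine Real.le_sqrt_of_sq_le ?_
  rw [mul_pow, Real.sq_sqrt (by positivity), mul_one_div]
  have hC : (n / 2 : ℝ) ^ 3 / k.factorial ≤ n.choose k := by
    refine le_trans ?_ (Nat.pow_le_choose (α := ℝ) k n)
    gcongr
    calc (n / 2 : ℝ) ^ 3 ≤ (n / 2) ^ k := pow_le_pow_right₀ (by linarith) hk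
      _ ≤ _ := by
        gcongr
        rw [div_le_iff₀ two_pos]
        exact_mod_cast (by omega : n ≤ (n + 1 - k) * 2)
  have hf : (0 : ℝ) < k.factorial := by exact_mod_cast k.factorial_pos
  have hpos : 0 < (n / 2 : ℝ) ^ 3 / k.factorial := by positivity
  calc (n : ℝ) ^ 2 / n.choose k ≤ n ^ 2 / ((n / 2 : ℝ) ^ 3 / k.factorial) := by gcongr
    _ = _ := by field_simp; norm_num

theorem tendsto_cube_add_one_mul_exp_neg {η : ℝ} (hη : 0 < η) :
    Tendsto (fun t : ℝ => (t ^ 3 + 1) * Real.exp (-(η * t))) atTop (nhds 0) := by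
  have hlin : Tendsto (fun t : ℝ => η * t) atTop atTop :=
    tendsto_id.const_mul_atTop hη
  have h3 := ((Real.tendsto_pow_mul_exp_neg_atTop_nhds_zero 3).comp hlin).const_mul (η ^ 3)⁻¹
  have h0 := (Real.tendsto_pow_mul_exp_neg_atTop_nhds_zero 0).comp hlin
  have h := h3.add h0
  rw [mul_zero, add_zero] at h
  refine h.congr fun t => ?_
  simp only [Function.comp]
  field_simp

/-- If `0 < c < 1` and `c < θ_k` (i.e. `c·ln(1+(1−2x)^k) < ln 2 + H(x)` for all
`x ∈ (0,1/2)`), then `E_{⌊c·n⌋,k}(Y) → 1` as `n → ∞`. -/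
theorem tendsto_EY_of_lt_theta (k : ℕ) (hk : 3 ≤ k) (c : ℝ) (hc0 : 0 < c) (hc1 : c < 1)
    (hθ : ∀ x : ℝ, 0 < x → x < 1 / 2 →
      c * Real.log (1 + (1 - 2 * x) ^ k) < Real.log 2 + Hent x) :
    Tendsto (fun n : ℕ => EY n ⌊c * n⌋₊ k) atTop (nhds 1) := by
  obtain ⟨η, hη0, hη⟩ := exists_quadratic_gap hk hc0 hc1 hθ
  have ht : Tendsto (fun n : ℕ => (n : ℝ) ^ (1 / 3 : ℝ)) atTop atTop :=
    (tendsto_rpow_atTop (by norm_num)).comp tendsto_natCast_atTop_atTop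
  have hlim := ((tendsto_mul_sqrt_one_div_choose hk).const_mul (Real.exp (1 + k ^ 2))).add
    (((tendsto_cube_add_one_mul_exp_neg hη0).comp ht).const_mul (Real.exp (k ^ 2)))
  rw [mul_zero, mul_zero, add_zero] at hlim
  rw [tendsto_iff_norm_sub_tendsto_zero]
  refine squeeze_zero' (Eventually.of_forall fun n => norm_nonneg _) ?_ hlim
  filter_upwards [eventually_ge_atTop k] with n hn
  have hn0 : (0 : ℝ) < n := by exact_mod_cast (by omega : 0 < n)
  have hL : (⌊c * n⌋₊ : ℝ) ≤ c * n := Nat.floor_le (by positivity)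
  refine abs_EY_sub_one_le hk hn hL (hL.trans (by nlinarith)) hη0 hη (by positivity) ?_
  rw [← Real.rpow_natCast, ← Real.rpow_mul hn0.le]
  norm_num
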